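/- Suppose (d*, x*) is an optimal solution to (MP1). Define u_{jk}* = x_{jk}* d_j* for all j = 1,…,J and k = 1,…,K, and d_0* = 1 − ∑_{j=1}^J d_j*. Then (d*, d_0*, u*) is an optimal solution to (MCOP1). -/

import Mathlib

open Finset

/-- Objective of problem (MP1). -/
noncomputable def MP1Obj {J K : ℕ} (φ : Fin J → Fin K → ℝ) (ψ : Fin J → ℝ)
    (d : Fin J → ℝ) (x : Fin J → Fin K → ℝ) : ℝ :=
  ∑ j, (∑ k, φ j k * x j k - ψ j) * d j

/-- Feasibility for problem (MP1). -/
def MP1Feasible {J K : ℕ} (xl xu : Fin J → Fin K → ℝ)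
    (d : Fin J → ℝ) (x : Fin J → Fin K → ℝ) : Prop :=
  (∀ j, d j = Real.exp (-(∑ k, x j k)) / (1 + ∑ j', Real.exp (-(∑ k, x j' k)))) ∧
  (∀ j k, xl j k ≤ x j k ∧ x j k ≤ xu j k)

/-- Optimality for problem (MP1). -/
def MP1Optimal {J K : ℕ} (φ : Fin J → Fin K → ℝ) (ψ : Fin J → ℝ)
    (xl xu : Fin J → Fin K → ℝ) (d : Fin J → ℝ) (x : Fin J → Fin K → ℝ) : Prop :=
  MP1Feasible xl xu d x ∧
  ∀ d' x', MP1Feasible xl xu d' x' → MP1Obj φ ψ d' x' ≤ MP1Obj φ ψ d x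

/-- Objective of problem (MCOP1). -/
noncomputable def MCOP1Obj {J K : ℕ} (φ : Fin J → Fin K → ℝ) (ψ : Fin J → ℝ)
    (d : Fin J → ℝ) (u : Fin J → Fin K → ℝ) : ℝ :=
  ∑ j, (∑ k, φ j k * u j k - ψ j * d j)

/-- Feasibility for problem (MCOP1). -/
def MCOP1Feasible {J K : ℕ} (xl xu : Fin J → Fin K → ℝ)
    (d : Fin J → ℝ) (d0 : ℝ) (u : Fin J → Fin K → ℝ) : Prop :=
  (∀ j, d j * Real.log (d j / d0) ≤ -(∑ k, u j k)) ∧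
  (∀ j, d0 * Real.log (d0 / d j) ≤ d0 * ∑ k, xu j k) ∧
  (∀ j k, xl j k * d j ≤ u j k ∧ u j k ≤ xu j k * d j) ∧
  (d0 + ∑ j, d j = 1) ∧
  (∀ j, 0 < d j) ∧ 0 < d0

/-- Optimality for problem (MCOP1). -/
def MCOP1Optimal {J K : ℕ} (φ : Fin J → Fin K → ℝ) (ψ : Fin J → ℝ)
    (xl xu : Fin J → Fin K → ℝ)
    (d : Fin J → ℝ) (d0 : ℝ) (u : Fin J → Fin K → ℝ) : Prop :=
  MCOP1Feasible xl xu d d0 u ∧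
  ∀ d' d0' u', MCOP1Feasible xl xu d' d0' u' → MCOP1Obj φ ψ d' u' ≤ MCOP1Obj φ ψ d u

/-- A number between `∑ y` and `∑ b`, where `y ≤ b`, is the sum of some vector between them. -/
lemma exists_between_sum_eq {ι : Type*} [Fintype ι] (y b : ι → ℝ) (hyb : ∀ i, y i ≤ b i)
    (L : ℝ) (hyL : ∑ i, y i ≤ L) (hLb : L ≤ ∑ i, b i) :
    ∃ x : ι → ℝ, (∀ i, y i ≤ x i ∧ x i ≤ b i) ∧ ∑ i, x i = L := by
  rcases (hyL.trans hLb).eq_or_lt with h | h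
  · exact ⟨y, fun i => ⟨le_rfl, hyb i⟩, by linarith⟩
  have hS : 0 < ∑ i, b i - ∑ i, y i := sub_pos.2 h
  set t := (L - ∑ i, y i) / (∑ i, b i - ∑ i, y i) with ht
  have ht0 : 0 ≤ t := div_nonneg (sub_nonneg.2 hyL) hS.le
  have ht1 : t ≤ 1 := (div_le_one hS).2 (by linarith)
  refine ⟨fun i => y i + t * (b i - y i), fun i => ⟨?_, ?_⟩, ?_⟩
  · nlinarith [hyb i]
  · nlinarith [hyb i]
  · rw [sum_add_distrib, ← mul_sum, sum_sub_distrib, ht, div_mul_cancel₀ _ hS.ne']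
    ring

lemma MCOP1Obj_mul_eq_MP1Obj {J K : ℕ} (φ : Fin J → Fin K → ℝ) (ψ : Fin J → ℝ)
    (d : Fin J → ℝ) (x : Fin J → Fin K → ℝ) :
    MCOP1Obj φ ψ d (fun j k => x j k * d j) = MP1Obj φ ψ d x := by
  simp only [MCOP1Obj, MP1Obj, sub_mul, sum_mul, mul_assoc]

/-- Every feasible point of (MP1) gives a feasible point of (MCOP1). -/
lemma MP1Feasible.mcop1Feasible {J K : ℕ} {xl xu : Fin J → Fin K → ℝ}
    {d : Fin J → ℝ} {x : Fin J → Fin K → ℝ} (h : MP1Feasible xl xu d x) :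
    MCOP1Feasible xl xu d (1 - ∑ j, d j) (fun j k => x j k * d j) := by
  obtain ⟨hd, hx⟩ := h
  set D := 1 + ∑ j, Real.exp (-(∑ k, x j k)) with hD
  have hDpos : 0 < D := by positivity
  have hd0 : 1 - ∑ j, d j = 1 / D := by
    simp only [hd, ← sum_div]
    field_simp
    rw [hD]
    ring
  have hdpos : ∀ j, 0 < d j := fun j => by rw [hd j]; positivity
  have hratio : ∀ j, d j / (1 / D) = Real.exp (-(∑ k, x j k)) := fun j => by
    rw [hd j]
    field_simp
  refine ⟨fun j => ?_, fun j => ?_, fun j k => ?_, by ring, hdpos, ?_⟩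
  · rw [hd0, hratio, Real.log_exp, ← sum_mul]
    exact le_of_eq (by ring)
  · rw [hd0, ← inv_div (d j), hratio, Real.log_inv, Real.log_exp, neg_neg]
    gcongr with k
    exact (hx j k).2
  · exact ⟨mul_le_mul_of_nonneg_right (hx j k).1 (hdpos j).le,
      mul_le_mul_of_nonneg_right (hx j k).2 (hdpos j).le⟩
  · rw [hd0]
    positivity

/-- Every feasible point of (MCOP1) is dominated by a feasible point of (MP1) with the same `d`. -/
lemma MCOP1Feasible.exists_mp1Feasible_ge {J K : ℕ} {φ : Fin J → Fin K → ℝ}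
    (hφ : ∀ j k, 0 ≤ φ j k) (ψ : Fin J → ℝ) {xl xu : Fin J → Fin K → ℝ}
    {d : Fin J → ℝ} {d0 : ℝ} {u : Fin J → Fin K → ℝ} (h : MCOP1Feasible xl xu d d0 u) :
    ∃ x, MP1Feasible xl xu d x ∧ MCOP1Obj φ ψ d u ≤ MP1Obj φ ψ d x := by
  obtain ⟨hlog, hlog0, hu, hsum, hd, hd0⟩ := h
  have hex : ∀ j, ∃ x : Fin K → ℝ, (∀ k, u j k / d j ≤ x k ∧ x k ≤ xu j k) ∧
      ∑ k, x k = Real.log (d0 / d j) := fun j => by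
    refine exists_between_sum_eq _ _ (fun k => (div_le_iff₀ (hd j)).2 (hu j k).2) _ ?_
      (le_of_mul_le_mul_left (hlog0 j) hd0)
    rw [← sum_div, div_le_iff₀ (hd j), ← inv_div, Real.log_inv]
    linarith [hlog j]
  choose x hx hxsum using hex
  have hexp : ∀ j, Real.exp (-(∑ k, x j k)) = d j / d0 := fun j => by
    rw [hxsum, ← Real.log_inv, inv_div, Real.exp_log (div_pos (hd j) hd0)]
  refine ⟨x, ⟨fun j => ?_, fun j k => ⟨?_, (hx j k).2⟩⟩, ?_⟩
  · have hD : 1 + ∑ j, d j / d0 = 1 / d0 := by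
      rw [← sum_div]
      field_simp
      exact hsum
    simp only [hexp, hD]
    field_simp
  · exact ((le_div_iff₀ (hd j)).2 (hu j k).1).trans (hx j k).1
  · rw [← MCOP1Obj_mul_eq_MP1Obj]
    unfold MCOP1Obj
    gcongr with j _ k
    · exact hφ j k
    · exact (div_le_iff₀ (hd j)).1 (hx j k).1

/-- an optimal solution of (MP1) transforms into an optimal
solution of (MCOP1) via `u_{jk} = x_{jk} d_j` and `d_0 = 1 − ∑_j d_j`. -/
theorem mp1_optimal_to_mcop1_optimal (J K : ℕ) (hJ : 0 < J) (hK : 0 < K)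
    (φ : Fin J → Fin K → ℝ) (hφ : ∀ j k, 0 < φ j k) (ψ : Fin J → ℝ)
    (xl xu : Fin J → Fin K → ℝ) (hbounds : ∀ j k, xl j k ≤ xu j k)
    (d : Fin J → ℝ) (x : Fin J → Fin K → ℝ)
    (hopt : MP1Optimal φ ψ xl xu d x)
    (u : Fin J → Fin K → ℝ) (hu : ∀ j k, u j k = x j k * d j)
    (d0 : ℝ) (hd0 : d0 = 1 - ∑ j, d j) :
    MCOP1Optimal φ ψ xl xu d d0 u := by
  obtain rfl : u = fun j k => x j k * d j := by
    ext j k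
    exact hu j k
  subst hd0
  refine ⟨hopt.1.mcop1Feasible, fun d' d0' u' h' => ?_⟩
  obtain ⟨x', hx', hle⟩ := h'.exists_mp1Feasible_ge (fun j k => (hφ j k).le) ψ
  rw [MCOP1Obj_mul_eq_MP1Obj]
  exact hle.trans (hopt.2 d' x' hx')
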